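/- Let A be a left Leibniz algebra over a field F. Assume that for every left Leibniz algebra K over F, every ideal J of K that is isomorphic to A as a Leibniz algebra, and every Lie-derivation f ∈ D_Lie(K), one has f(J) ⊆ J. Then A is perfect. -/

import Mathlib

universe u v w

class LeibnizAlgebra (F : Type u) (A : Type v) [Field F] [AddCommGroup A] [Module F A]
    extends Bracket A A where
  add_lie' : ∀ x y z : A, ⁅x + y, z⁆ = ⁅x, z⁆ + ⁅y, z⁆
  lie_add' : ∀ x y z : A, ⁅x, y + z⁆ = ⁅x, y⁆ + ⁅x, z⁆
  smul_lie' : ∀ (t : F) (x y : A), ⁅t • x, y⁆ = t • ⁅x, y⁆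
  lie_smul' : ∀ (t : F) (x y : A), ⁅x, t • y⁆ = t • ⁅x, y⁆
  leibniz' : ∀ x y z : A, ⁅x, ⁅y, z⁆⁆ = ⁅⁅x, y⁆, z⁆ + ⁅y, ⁅x, z⁆⁆

section Defs

variable (F : Type u) {A : Type v} [Field F] [AddCommGroup A] [Module F A] [LeibnizAlgebra F A]

/-- The bracket of a Leibniz algebra, as a bilinear map. -/
def leibnizBracketHom : A →ₗ[F] A →ₗ[F] A :=
  LinearMap.mk₂ F (fun x y => ⁅x, y⁆) LeibnizAlgebra.add_lie' LeibnizAlgebra.smul_lie'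
    LeibnizAlgebra.lie_add' LeibnizAlgebra.lie_smul'

@[simp] lemma leibnizBracketHom_apply (x y : A) : leibnizBracketHom F x y = ⁅x, y⁆ := rfl

/-- A derivation of a Leibniz algebra. -/
def IsLeibnizDeriv (f : A →ₗ[F] A) : Prop :=
  ∀ x y : A, f ⁅x, y⁆ = ⁅f x, y⁆ + ⁅x, f y⁆

/-- A subalgebra of a Leibniz algebra: a subspace closed under the bracket. -/
def IsLeibnizSubalg (S : Submodule F A) : Prop := ∀ x ∈ S, ∀ y ∈ S, ⁅x, y⁆ ∈ S

/-- A (two-sided) ideal of a Leibniz algebra. -/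
def IsLeibnizIdeal (J : Submodule F A) : Prop :=
  ∀ (x : A), ∀ y ∈ J, ⁅x, y⁆ ∈ J ∧ ⁅y, x⁆ ∈ J

/-- `J` is an ideal of the subalgebra `S`. -/
def IsLeibnizIdealIn (J S : Submodule F A) : Prop :=
  J ≤ S ∧ ∀ x ∈ S, ∀ y ∈ J, ⁅x, y⁆ ∈ J ∧ ⁅y, x⁆ ∈ J

/-- A subspace is perfect if it is spanned by brackets of its own elements. -/
def IsPerfectCarrier (S : Submodule F A) : Prop :=
  Submodule.span F {z : A | ∃ x ∈ S, ∃ y ∈ S, z = ⁅x, y⁆} = S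

/-- A Leibniz algebra is perfect if it coincides with its derived subalgebra. -/
def IsPerfectLeibniz (A : Type v) [AddCommGroup A] [Module F A] [LeibnizAlgebra F A] : Prop :=
  Submodule.span F {z : A | ∃ x y : A, z = ⁅x, y⁆} = ⊤

end Defs

section Lemmas
variable {F : Type u} {A : Type v} [Field F] [AddCommGroup A] [Module F A] [LeibnizAlgebra F A]

lemma zero_lie' (y : A) : ⁅(0 : A), y⁆ = 0 := by
  rw [← leibnizBracketHom_apply F]; exact LinearMap.map_zero₂ (leibnizBracketHom F) y

lemma lie_zero' (x : A) : ⁅x, (0 : A)⁆ = 0 := by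
  rw [← leibnizBracketHom_apply F]; exact (leibnizBracketHom F x).map_zero

lemma sub_lie' (x y z : A) : ⁅x - y, z⁆ = ⁅x, z⁆ - ⁅y, z⁆ := by
  simp only [← leibnizBracketHom_apply F]; exact LinearMap.map_sub₂ (leibnizBracketHom F) x y z

lemma lie_sub' (x y z : A) : ⁅x, y - z⁆ = ⁅x, y⁆ - ⁅x, z⁆ := by
  simp only [← leibnizBracketHom_apply F]; exact (leibnizBracketHom F x).map_sub y z

end Lemmas
section Center

variable (F : Type u) (A : Type v) [Field F] [AddCommGroup A] [Module F A] [LeibnizAlgebra F A]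

/-- The Lie-center `Z_Lie(A) = {x : [x,y] + [y,x] = 0 for all y}` of a Leibniz algebra. -/
def lieCenterLeibniz : Submodule F A where
  carrier := {x : A | ∀ y : A, ⁅x, y⁆ + ⁅y, x⁆ = 0}
  zero_mem' := by
    intro y
    have h1 : ⁅(0 : A), y⁆ = 0 := LinearMap.map_zero₂ (leibnizBracketHom F) y
    have h2 : ⁅y, (0 : A)⁆ = 0 := (leibnizBracketHom F y).map_zero
    rw [h1, h2, add_zero]
  add_mem' := by
    intro a b ha hb y
    have h1 : ⁅a + b, y⁆ = ⁅a, y⁆ + ⁅b, y⁆ := LeibnizAlgebra.add_lie' a b y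
    have h2 : ⁅y, a + b⁆ = ⁅y, a⁆ + ⁅y, b⁆ := LeibnizAlgebra.lie_add' y a b
    rw [h1, h2]
    have := ha y
    have := hb y
    abel_nf
    linear_combination (norm := abel) ha y + hb y
  smul_mem' := by
    intro t a ha y
    have h1 : ⁅t • a, y⁆ = t • ⁅a, y⁆ := LeibnizAlgebra.smul_lie' t a y
    have h2 : ⁅y, t • a⁆ = t • ⁅y, a⁆ := LeibnizAlgebra.lie_smul' t y a
    rw [h1, h2, ← smul_add, ha y, smul_zero]

/-- A Lie-derivation of a Leibniz algebra: a derivation whose image lies in the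
Lie-center. -/
def IsLieDerivOfLeibniz (f : A →ₗ[F] A) : Prop :=
  IsLeibnizDeriv F f ∧ ∀ x : A, f x ∈ lieCenterLeibniz F A

end Center

/-- `J` is (the image of) an isomorphic copy of the Leibniz algebra `A` inside `K`. -/
def IsIsoCopy (F : Type u) (A : Type v) [Field F] [AddCommGroup A] [Module F A]
    [LeibnizAlgebra F A] {K : Type v} [AddCommGroup K] [Module F K] [LeibnizAlgebra F K]
    (J : Submodule F K) : Prop :=
  ∃ e : A →ₗ[F] K, Function.Injective e ∧ LinearMap.range e = J ∧
    ∀ x y : A, e ⁅x, y⁆ = ⁅e x, e y⁆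

/-- The direct product of a Leibniz algebra `A` with an abelian Leibniz algebra `M`. -/
@[reducible] def LeibnizAlgebra.prodAbelian (F : Type u) (A : Type v) (M : Type w) [Field F]
    [AddCommGroup A] [Module F A] [LeibnizAlgebra F A] [AddCommGroup M] [Module F M] :
    LeibnizAlgebra F (A × M) where
  bracket x y := (⁅x.1, y.1⁆, 0)
  add_lie' x y z := Prod.ext (LeibnizAlgebra.add_lie' (F := F) x.1 y.1 z.1) (add_zero 0).symm
  lie_add' x y z := Prod.ext (LeibnizAlgebra.lie_add' (F := F) x.1 y.1 z.1) (add_zero 0).symm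
  smul_lie' t x y := Prod.ext (LeibnizAlgebra.smul_lie' t x.1 y.1) (smul_zero t).symm
  lie_smul' t x y := Prod.ext (LeibnizAlgebra.lie_smul' t x.1 y.1) (smul_zero t).symm
  leibniz' x y z := Prod.ext (LeibnizAlgebra.leibniz' (F := F) x.1 y.1 z.1) (add_zero 0).symm

theorem perfect_of_lieDeriv_invariant (F : Type u) (A : Type v) [Field F] [AddCommGroup A]
    [Module F A] [LeibnizAlgebra F A]
    (h : ∀ (K : Type v) [AddCommGroup K] [Module F K] [LeibnizAlgebra F K]
      (J : Submodule F K), IsLeibnizIdeal F J → IsIsoCopy F A J →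
      ∀ f : K →ₗ[F] K, IsLieDerivOfLeibniz F K f → ∀ x ∈ J, f x ∈ J) :
    IsPerfectLeibniz F A := by
  set D : Submodule F A := Submodule.span F {z : A | ∃ x y : A, z = ⁅x, y⁆}
  let _ := LeibnizAlgebra.prodAbelian F A (A ⧸ D)
  have bracket_eq (x y : A × (A ⧸ D)) : ⁅x, y⁆ = (⁅x.1, y.1⁆, 0) := rfl
  have mem_D (x y : A) : ⁅x, y⁆ ∈ D := Submodule.subset_span ⟨x, y, rfl⟩
  have lie_zero (x : A) : ⁅x, (0 : A)⁆ = 0 := lie_zero' (F := F) x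
  have zero_lie (x : A) : ⁅(0 : A), x⁆ = 0 := zero_lie' (F := F) x
  let f : A × (A ⧸ D) →ₗ[F] A × (A ⧸ D) :=
    LinearMap.inr F A (A ⧸ D) ∘ₗ D.mkQ ∘ₗ LinearMap.fst F A (A ⧸ D)
  have f_eq (x : A × (A ⧸ D)) : f x = (0, D.mkQ x.1) := rfl
  have ideal : IsLeibnizIdeal F (LinearMap.range (LinearMap.inl F A (A ⧸ D))) :=
    fun x y _ => ⟨⟨⁅x.1, y.1⁆, rfl⟩, ⟨⁅y.1, x.1⁆, rfl⟩⟩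
  have copy : IsIsoCopy F A (LinearMap.range (LinearMap.inl F A (A ⧸ D))) :=
    ⟨LinearMap.inl F A (A ⧸ D), LinearMap.inl_injective, rfl, fun _ _ => rfl⟩
  have deriv : IsLieDerivOfLeibniz F (A × (A ⧸ D)) f := by
    refine ⟨fun x y => ?_, fun x y => ?_⟩
    · have hxy : D.mkQ ⁅x.1, y.1⁆ = 0 := (Submodule.Quotient.mk_eq_zero D).2 (mem_D _ _)
      simp [bracket_eq, f_eq, lie_zero, zero_lie, hxy, -Submodule.mkQ_apply]
    · simp [bracket_eq, f_eq, lie_zero, zero_lie]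
  refine (Submodule.eq_top_iff' (p := D)).2 fun x => ?_
  obtain ⟨a, ha⟩ := h _ _ ideal copy f deriv (x, 0) ⟨x, rfl⟩
  exact (Submodule.Quotient.mk_eq_zero D).1 (congrArg Prod.snd ha).symm
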